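/- arXiv:1502.03945 — 9 statements merged into one kernel-verified Lean document; each statement's English description precedes it below -/
import Mathlib

section
/- For every integer n ≥ 1 and every real α ∈ (0,1), consider the price competition game with a single (non-abstain) vendor of production cost 0 and n buyer types, where buyer type i has volume μ_i = α^{i−1}, valuation v_i = (∑_{j=i}^n μ_j)^{−1} for the vendor when i ∈ {1,…,n−1}, and v_n = (1+α)/μ_n. Then the price p = v_n for the vendor, together with the consistent assignment in which all buyers of type n are assigned to the vendor and all buyers of types 1,…,n−1 abstain, forms an equilibrium whose social welfare equals 1+α, while the optimal social welfare is at least (1−α)·n; consequently the price of anarchy of this game is at least (1−α)n/(1+α). -/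
open Finset

/-- A price competition game with buyer types `N` and vendors `M`
(including the special "abstain" vendor). -/
structure PCGame (N M : Type) [Fintype N] [Fintype M] where
  abstain : M
  μ : N → ℝ
  v : N → M → ℝ
  c : M → ℝ
  μ_pos : ∀ i, 0 < μ i
  v_nonneg : ∀ i j, 0 ≤ v i j
  c_nonneg : ∀ j, 0 ≤ c j
  v_abstain : ∀ i, v i abstain = 0
  c_abstain : c abstain = 0

namespace PCGame

variable {N M : Type} [Fintype N] [Fintype M]

/-- `p` is a valid price vector: every price is at least the production cost and
the abstain vendor has price `0`. -/
def IsPrice (G : PCGame N M) (p : M → ℝ) : Prop :=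
  (∀ j, G.c j ≤ p j) ∧ p G.abstain = 0

/-- `x` is a valid buyers-to-vendors assignment. -/
def IsAssignment (G : PCGame N M) (x : N → M → ℝ) : Prop :=
  (∀ i j, 0 ≤ x i j) ∧ ∀ i, ∑ j, x i j = G.μ i

/-- `x` is consistent to `p`: positive volume goes only to utility-maximizing vendors. -/
def Consistent (G : PCGame N M) (x : N → M → ℝ) (p : M → ℝ) : Prop :=
  ∀ i j, 0 < x i j → ∀ j', G.v i j' - p j' ≤ G.v i j - p j

/-- Utility of vendor `j` under assignment `x` and prices `p`. -/
noncomputable def util (G : PCGame N M) (x : N → M → ℝ) (p : M → ℝ) (j : M) : ℝ :=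
  (p j - G.c j) * ∑ i, x i j

/-- Total utility of the buyers of type `i`. -/
noncomputable def buyerUtil (G : PCGame N M) (x : N → M → ℝ) (p : M → ℝ) (i : N) : ℝ :=
  ∑ j, x i j * (G.v i j - p j)

/-- `(x, p)` is a (pure Nash) equilibrium: `x` is consistent to `p` and no (non-abstain)
vendor can increase its utility by deviating to another price. -/
def IsEquilibrium [DecidableEq M] (G : PCGame N M) (x : N → M → ℝ) (p : M → ℝ) : Prop :=
  G.IsPrice p ∧ G.IsAssignment x ∧ G.Consistent x p ∧
    ∀ j, j ≠ G.abstain → ∀ p' : ℝ, G.c j ≤ p' →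
      ∀ y, G.IsAssignment y → G.Consistent y (Function.update p j p') →
        G.util y (Function.update p j p') j ≤ G.util x p j

/-- Social welfare of assignment `x`. -/
noncomputable def SW (G : PCGame N M) (x : N → M → ℝ) : ℝ :=
  ∑ i, ∑ j, x i j * (G.v i j - G.c j)

/-- Optimal social welfare. -/
noncomputable def SWopt (G : PCGame N M) : ℝ :=
  ∑ i, G.μ i * Finset.univ.sup' ⟨G.abstain, Finset.mem_univ _⟩ (fun j => G.v i j - G.c j)

/-- `θ_j(p)`: the supremum utility of vendor `j` over all of its price deviations
(the abstain vendor cannot deviate from price `0`). -/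
noncomputable def theta [DecidableEq M] (G : PCGame N M) (p : M → ℝ) (j : M) : ℝ :=
  sSup {u : ℝ | ∃ (p' : ℝ) (y : N → M → ℝ), G.c j ≤ p' ∧ (j = G.abstain → p' = 0) ∧
    G.IsAssignment y ∧ G.Consistent y (Function.update p j p') ∧
    u = G.util y (Function.update p j p') j}

/-- The minimum subsidy that makes vendor `j` not want to deviate from `(x, p)`. -/
noncomputable def subsidy [DecidableEq M] (G : PCGame N M) (x : N → M → ℝ) (p : M → ℝ)
    (j : M) : ℝ :=
  G.theta p j - G.util x p j

end PCGame

/-- A tail of the geometric sequence, summed over `Fin n`. -/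
theorem sum_fin_ite_pow_eq_sum_Ico (α : ℝ) (n k : ℕ) :
    ∑ i : Fin n, (if k ≤ (i : ℕ) then α ^ (i : ℕ) else 0) = ∑ j ∈ Finset.Ico k n, α ^ j := by
  rw [Fin.sum_univ_eq_sum_range (fun j => if k ≤ j then α ^ j else 0) n, ← Finset.sum_filter]
  congr 1
  ext j
  simp only [Finset.mem_filter, Finset.mem_range, Finset.mem_Ico]
  omega

theorem sum_Ico_pow_pos {α : ℝ} (hα : 0 < α) {k n : ℕ} (hk : k < n) :
    0 < ∑ j ∈ Finset.Ico k n, α ^ j :=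
  Finset.sum_pos (fun _ _ => pow_pos hα _) ⟨k, Finset.mem_Ico.2 ⟨le_rfl, hk⟩⟩

theorem one_sub_mul_sum_Ico_pow_le {α : ℝ} (hα : 0 ≤ α) (k n : ℕ) (hk : k ≤ n) :
    (1 - α) * ∑ j ∈ Finset.Ico k n, α ^ j ≤ α ^ k := by
  have h := geom_sum_Ico_mul α hk
  have := pow_nonneg hα n
  linarith

theorem pow_le_sum_Ico_pow {α : ℝ} (hα : 0 ≤ α) {k j n : ℕ} (hkj : k ≤ j) (hj : j < n) :
    α ^ j ≤ ∑ l ∈ Finset.Ico k n, α ^ l :=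
  Finset.single_le_sum (f := fun l => α ^ l) (fun _ _ => pow_nonneg hα _)
    (Finset.mem_Ico.2 ⟨hkj, hj⟩)

namespace PCGame

/-- With one vendor besides the abstain vendor, buyers of a type that buys a positive volume value
the vendor at least at its price. -/
theorem Consistent.price_le {N : Type} [Fintype N] {G : PCGame N Bool} {y : N → Bool → ℝ}
    {q : Bool → ℝ} (hab : G.abstain = false) (hq : q false = 0) (hy : G.Consistent y q) {i : N}
    (hi : 0 < y i true) : q true ≤ G.v i true := by
  have h := hy i true hi false
  have h0 := G.v_abstain i
  rw [hab] at h0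
  linarith

/-- Every assignment gives a vendor at most the volume of the buyer types. -/
theorem IsAssignment.le_volume {N M : Type} [Fintype N] [Fintype M] {G : PCGame N M}
    {y : N → M → ℝ} (hy : G.IsAssignment y) (i : N) (j : M) : y i j ≤ G.μ i :=
  hy.2 i ▸ Finset.single_le_sum (fun l _ => hy.1 i l) (Finset.mem_univ j)

/-- In a one-vendor game with geometric volumes, where charging any type's valuation to it and to
all later types brings at most `B`, every consistent assignment brings at most `B`. -/
theorem mul_sum_le_of_consistent {n : ℕ} {α : ℝ} (hα : 0 ≤ α) {G : PCGame (Fin n) Bool}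
    (hab : G.abstain = false) (hμ : ∀ i : Fin n, G.μ i = α ^ (i : ℕ)) {B : ℝ} (hB0 : 0 ≤ B)
    (hB : ∀ i : Fin n, G.v i true * ∑ j ∈ Finset.Ico (i : ℕ) n, α ^ j ≤ B)
    {y : Fin n → Bool → ℝ} {q : Bool → ℝ} (hq0 : q false = 0) (hq1 : 0 ≤ q true)
    (hy : G.IsAssignment y) (hc : G.Consistent y q) : q true * ∑ i, y i true ≤ B := by
  by_cases hex : ∃ i, 0 < y i true
  · obtain ⟨k, hk, hmin⟩ := WellFounded.has_min (wellFounded_lt (α := Fin n)) {i | 0 < y i true} hex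
    have hle : ∑ i, y i true ≤ ∑ j ∈ Finset.Ico (k : ℕ) n, α ^ j := by
      rw [← sum_fin_ite_pow_eq_sum_Ico]
      refine Finset.sum_le_sum fun i _ => ?_
      split_ifs with h
      · exact hμ i ▸ hy.le_volume i true
      · exact not_lt.1 fun hi => hmin i hi (not_le.1 h)
    calc q true * ∑ i, y i true ≤ q true * ∑ j ∈ Finset.Ico (k : ℕ) n, α ^ j :=
          mul_le_mul_of_nonneg_left hle hq1
      _ ≤ G.v k true * ∑ j ∈ Finset.Ico (k : ℕ) n, α ^ j :=
          mul_le_mul_of_nonneg_right (hc.price_le hab hq0 hk)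
            (Finset.sum_nonneg fun _ _ => pow_nonneg hα _)
      _ ≤ B := hB k
  · push Not at hex
    exact (mul_nonpos_of_nonneg_of_nonpos hq1 (Finset.sum_nonpos fun i _ => hex i)).trans hB0

/-- Serving every buyer type by a fixed vendor is a lower bound for the optimum. -/
theorem sum_mul_le_SWopt {N M : Type} [Fintype N] [Fintype M] (G : PCGame N M) (j : M) :
    ∑ i, G.μ i * (G.v i j - G.c j) ≤ G.SWopt :=
  Finset.sum_le_sum fun i _ => mul_le_mul_of_nonneg_left
    (Finset.le_sup' (fun j => G.v i j - G.c j) (Finset.mem_univ j)) (G.μ_pos i).le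

end PCGame

/-- the one-vendor lower bound game from Lemma 1. -/
theorem stmt0 (n : ℕ) (hn : 1 ≤ n) (α : ℝ) (hα0 : 0 < α) (hα1 : α < 1)
    (G : PCGame (Fin n) Bool)
    (hab : G.abstain = false)
    (hμ : ∀ i : Fin n, G.μ i = α ^ (i : ℕ))
    (hc : G.c true = 0)
    (hv : ∀ i : Fin n, (i : ℕ) < n - 1 → G.v i true = (∑ j ∈ Finset.Ico (i : ℕ) n, α ^ j)⁻¹)
    (hvn : G.v ⟨n - 1, by omega⟩ true = (1 + α) / α ^ (n - 1))
    (p : Bool → ℝ) (hp : p = fun j => if j = true then (1 + α) / α ^ (n - 1) else 0)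
    (x : Fin n → Bool → ℝ)
    (hx : x = fun (i : Fin n) (j : Bool) => if (i : ℕ) = n - 1 then (if j = true then G.μ i else 0)
      else (if j = false then G.μ i else 0)) :
    G.IsEquilibrium x p ∧ G.SW x = 1 + α ∧ (1 - α) * n ≤ G.SWopt ∧
      (1 - α) * n / (1 + α) ≤ G.SWopt / G.SW x := by
  have hlast : ∀ i : Fin n, (i : ℕ) = n - 1 → G.v i true = (1 + α) / α ^ (n - 1) := by
    intro i hi
    rw [← hvn]
    congr 1
    exact Fin.ext hi
  have hlt : ∀ i : Fin n, (i : ℕ) ≠ n - 1 → (i : ℕ) < n - 1 := fun i hi => by omega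
  have hP : 0 < α ^ (n - 1) := pow_pos hα0 _
  have hcf : G.c false = 0 := hab ▸ G.c_abstain
  have hvf : ∀ i, G.v i false = 0 := fun i => hab ▸ G.v_abstain i
  have hpt : p true = (1 + α) / α ^ (n - 1) := by simp [hp]
  have hpf : p false = 0 := by simp [hp]
  have hpt0 : 0 ≤ p true := hpt ▸ by positivity
  have hxt : ∀ i : Fin n, x i true = if i = ⟨n - 1, by omega⟩ then G.μ i else 0 := by
    intro i
    simp [hx, Fin.ext_iff]
  have hxf : ∀ i : Fin n, x i false = if (i : ℕ) = n - 1 then 0 else G.μ i := by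
    intro i
    simp [hx]
  have hvle : ∀ i : Fin n, G.v i true ≤ p true := by
    intro i
    rw [hpt]
    by_cases hi : (i : ℕ) = n - 1
    · exact (hlast i hi).le
    · rw [hv i (hlt i hi)]
      calc (∑ j ∈ Finset.Ico (i : ℕ) n, α ^ j)⁻¹ ≤ (α ^ (n - 1))⁻¹ :=
            inv_anti₀ hP (pow_le_sum_Ico_pow hα0.le (by omega) (by omega))
        _ ≤ (1 + α) / α ^ (n - 1) := by
            rw [inv_eq_one_div]
            gcongr
            linarith
  have hrev : ∀ i : Fin n, G.v i true * ∑ j ∈ Finset.Ico (i : ℕ) n, α ^ j ≤ 1 + α := by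
    intro i
    by_cases hi : (i : ℕ) = n - 1
    · have hI : Finset.Ico (n - 1) n = {n - 1} := by
        ext j
        simp only [Finset.mem_Ico, Finset.mem_singleton]
        omega
      rw [hlast i hi, hi, hI, Finset.sum_singleton, div_mul_cancel₀ _ hP.ne']
    · rw [hv i (hlt i hi), inv_mul_cancel₀ (sum_Ico_pow_pos hα0 i.2).ne']
      linarith
  have hwel : ∀ i : Fin n, 1 - α ≤ G.μ i * (G.v i true - G.c true) := by
    intro i
    rw [hc, sub_zero, hμ]
    by_cases hi : (i : ℕ) = n - 1
    · rw [hlast i hi, hi, mul_div_cancel₀ _ hP.ne']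
      linarith
    · rw [hv i (hlt i hi), ← div_eq_mul_inv, le_div_iff₀ (sum_Ico_pow_pos hα0 i.2)]
      exact one_sub_mul_sum_Ico_pow_le hα0.le _ _ i.2.le
  have hsum : ∑ i, x i true = α ^ (n - 1) := by
    simp [hxt, hμ]
  have hutil : G.util x p true = 1 + α := by
    rw [PCGame.util, hsum, hc, hpt, sub_zero, div_mul_cancel₀ _ hP.ne']
  have hSW : G.SW x = 1 + α := by
    simp only [PCGame.SW, Fintype.sum_bool, hvf, hcf, hc, hxt, sub_zero, mul_zero, add_zero,
      ite_mul, zero_mul, Finset.sum_ite_eq', Finset.mem_univ, if_true, hμ, hvn]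
    exact mul_div_cancel₀ _ hP.ne'
  have hopt : (1 - α) * n ≤ G.SWopt := by
    refine le_trans ?_ (G.sum_mul_le_SWopt true)
    calc (1 - α) * n = ∑ _i : Fin n, (1 - α) := by
          rw [Finset.sum_const, Finset.card_univ, Fintype.card_fin, nsmul_eq_mul, mul_comm]
      _ ≤ _ := Finset.sum_le_sum fun i _ => hwel i
  have hassign : G.IsAssignment x := by
    refine ⟨fun i j => ?_, fun i => ?_⟩
    · have := (G.μ_pos i).le
      rw [hx]
      dsimp only
      split_ifs <;> first | assumption | exact le_rfl
    · rw [Fintype.sum_bool, hxt, hxf]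
      simp only [Fin.ext_iff]
      split_ifs <;> simp
  have hcons : G.Consistent x p := by
    have hbuy : ∀ i : Fin n, 0 < x i true → G.v i true = p true := by
      intro i hi
      rw [hxt] at hi
      split_ifs at hi with h
      · rw [hpt, h, hvn]
      · exact absurd hi (lt_irrefl 0)
    intro i j hj j'
    have h1 := hvle i
    have h2 := hvf i
    cases j <;> cases j'
    · exact le_rfl
    · linarith
    · linarith [hbuy i hj]
    · exact le_rfl
  refine ⟨⟨⟨?_, hab ▸ hpf⟩, hassign, hcons, ?_⟩, hSW, hopt, ?_⟩
  · rintro (_ | _)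
    · rw [hcf, hpf]
    · rwa [hc]
  · intro j hj p' hp' y hy hyc
    have hjt : j = true := by simpa [hab] using hj
    subst hjt
    rw [hutil, PCGame.util, hc, sub_zero]
    refine PCGame.mul_sum_le_of_consistent hα0.le hab hμ (by linarith) hrev ?_ ?_ hy hyc
    · simp [hpf]
    · simpa [hc] using hp'
  · rw [hSW]
    gcongr
end

section
/- For every price competition game with n buyer types and every equilibrium (x,p) of the game, n·SW(x) ≥ SW*. In other words, the price of anarchy of any price competition game with n buyer types is at most n. -/
open Finset

namespace PCGame

section Welfare

variable {N M : Type} [Fintype N] [Fintype M]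

theorem SW_eq_sum_buyerUtil_add_sum_util (G : PCGame N M) (x : N → M → ℝ) (p : M → ℝ) :
    G.SW x = ∑ i, G.buyerUtil x p i + ∑ j, G.util x p j := by
  have hutil : ∑ j, G.util x p j = ∑ i, ∑ j, x i j * (p j - G.c j) := by
    rw [Finset.sum_comm]
    refine Finset.sum_congr rfl fun j _ => ?_
    rw [util, mul_comm, Finset.sum_mul]
  rw [hutil, ← Finset.sum_add_distrib, SW]
  refine Finset.sum_congr rfl fun i _ => ?_
  rw [buyerUtil, ← Finset.sum_add_distrib]
  exact Finset.sum_congr rfl fun j _ => by ring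

theorem Consistent.buyerUtil_eq {G : PCGame N M} {x : N → M → ℝ} {p : M → ℝ}
    (hc : G.Consistent x p) (hx : G.IsAssignment x) {i : N} {k : M}
    (hk : ∀ j, G.v i j - p j ≤ G.v i k - p k) :
    G.buyerUtil x p i = G.μ i * (G.v i k - p k) := by
  rw [buyerUtil, ← hx.2 i, Finset.sum_mul]
  refine Finset.sum_congr rfl fun j _ => ?_
  rcases (hx.1 i j).eq_or_lt with h0 | hpos
  · simp [← h0]
  · rw [le_antisymm (hk j) (hc i j hpos k)]

theorem exists_favorite (G : PCGame N M) (p : M → ℝ) (i : N) :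
    ∃ k, ∀ j, G.v i j - p j ≤ G.v i k - p k := by
  have : Nonempty M := ⟨G.abstain⟩
  exact Finite.exists_max fun j => G.v i j - p j

/-- Ties can be broken so that a type with `j` among its favorites buys only from `j`. -/
theorem exists_consistent_assignment [DecidableEq M] (G : PCGame N M) (q : M → ℝ) {i : N} {j : M}
    (hj : ∀ l, G.v i l - q l ≤ G.v i j - q j) :
    ∃ y, G.IsAssignment y ∧ G.Consistent y q ∧ y i j = G.μ i := by
  classical
  choose f hf using G.exists_favorite q
  have hg : ∀ k l, G.v k l - q l ≤
      G.v k (Function.update f i j k) - q (Function.update f i j k) := by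
    intro k l
    by_cases hk : k = i
    · subst hk
      simpa using hj l
    · simpa [hk] using hf k l
  refine ⟨fun k l => if l = Function.update f i j k then G.μ k else 0,
    ⟨fun k l => ?_, fun k => by simp⟩, fun k l hpos => ?_, by simp⟩
  · dsimp only
    split_ifs
    exacts [(G.μ_pos k).le, le_rfl]
  · dsimp only at hpos
    split_ifs at hpos with hl
    · rw [hl]
      exact hg k
    · exact absurd hpos (lt_irrefl 0)

theorem IsEquilibrium.mul_le_SW [DecidableEq M] {G : PCGame N M} {x : N → M → ℝ} {p : M → ℝ}
    (h : G.IsEquilibrium x p) (i : N) (j : M) : G.μ i * (G.v i j - G.c j) ≤ G.SW x := by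
  obtain ⟨⟨hp, hp0⟩, hx, hc, hdev⟩ := h
  choose k hk using G.exists_favorite p
  have hk0 : ∀ i, 0 ≤ G.v i (k i) - p (k i) := fun i => by
    simpa [G.v_abstain, hp0] using hk i G.abstain
  have hb : ∀ i, 0 ≤ G.buyerUtil x p i := fun i => by
    rw [hc.buyerUtil_eq hx (hk i)]
    exact mul_nonneg (G.μ_pos i).le (hk0 i)
  have hu : ∀ j, 0 ≤ G.util x p j := fun j =>
    mul_nonneg (sub_nonneg.2 (hp j)) (Finset.sum_nonneg fun i _ => hx.1 i j)
  have hSW : G.buyerUtil x p i + G.util x p j ≤ G.SW x := by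
    rw [G.SW_eq_sum_buyerUtil_add_sum_util x p]
    exact add_le_add (Finset.single_le_sum (fun i _ => hb i) (Finset.mem_univ i))
      (Finset.single_le_sum (fun j _ => hu j) (Finset.mem_univ j))
  refine le_trans ?_ hSW
  rw [hc.buyerUtil_eq hx (hk i)]
  rcases le_total (G.v i j - G.c j) (G.v i (k i) - p (k i)) with hle | hle
  · exact le_add_of_le_of_nonneg (mul_le_mul_of_nonneg_left hle (G.μ_pos i).le) (hu j)
  by_cases hja : j = G.abstain
  · subst hja
    rw [G.v_abstain, G.c_abstain]
    simpa using add_nonneg (mul_nonneg (G.μ_pos i).le (hk0 i)) (hu _)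
  -- Vendor `j` could match the utility that type `i` currently gets and serve all of it.
  set p' := G.v i j - (G.v i (k i) - p (k i)) with hp'
  have hcp : G.c j ≤ p' := by linarith
  obtain ⟨y, hy, hyc, hyij⟩ := G.exists_consistent_assignment (Function.update p j p')
    (i := i) (j := j) fun l => by
      by_cases hl : l = j
      · rw [hl]
      · simpa [hl, hp'] using hk i l
  have hd := hdev j hja p' hcp y hy hyc
  have hvol : G.μ i ≤ ∑ i, y i j :=
    hyij ▸ Finset.single_le_sum (f := fun i => y i j) (fun i _ => hy.1 i j) (Finset.mem_univ i)
  have hrev : (p' - G.c j) * G.μ i ≤ G.util x p j := by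
    refine le_trans ?_ hd
    simpa [util] using mul_le_mul_of_nonneg_left hvol (sub_nonneg.2 hcp)
  rw [hp'] at hrev
  linarith

end Welfare

end PCGame

/-- the price of anarchy of any price competition game with `n` buyer
types is at most `n`. -/
theorem stmt1 {N M : Type} [Fintype N] [Fintype M] [DecidableEq M]
    (G : PCGame N M) (x : N → M → ℝ) (p : M → ℝ)
    (h : G.IsEquilibrium x p) :
    G.SWopt ≤ (Fintype.card N : ℝ) * G.SW x := by
  have hi : ∀ i ∈ (Finset.univ : Finset N),
      G.μ i * Finset.univ.sup' ⟨G.abstain, Finset.mem_univ _⟩ (fun j => G.v i j - G.c j) ≤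
        G.SW x := fun i _ => by
    obtain ⟨j, -, hj⟩ := Finset.exists_mem_eq_sup' (s := (Finset.univ : Finset M))
      ⟨G.abstain, Finset.mem_univ _⟩ (fun j => G.v i j - G.c j)
    rw [hj]
    exact h.mul_le_SW i j
  simpa [PCGame.SWopt] using Finset.sum_le_card_nsmul _ _ _ hi
end

section
/- Let (x,p) be an equilibrium of a price competition game and suppose there exist a buyer type i and two distinct non-abstain vendors j ≠ j' with x_{ij} > 0 and x_{ij'} > 0. Then p_j = c_j and p_{j'} = c_{j'}; moreover, the assignment x' obtained from x by moving all volume x_{ij'} from vendor j' to vendor j (leaving all other entries unchanged) is consistent to p, the pair (x',p) is also an equilibrium, and SW(x') = SW(x). -/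
open Finset

namespace PCGame

variable {N M : Type} [Fintype N] [Fintype M]

/-- If vendor `j` lowers its price to `q`, there is a consistent assignment giving `j` all of the
volume of every buyer type for which `j` is then a best choice, in particular of those who bought
from `j` before. -/
theorem exists_consistent_of_price_cut [DecidableEq M] {G : PCGame N M} {x : N → M → ℝ}
    {p : M → ℝ} (hx : G.IsAssignment x) (hc : G.Consistent x p) {j : M} {q : ℝ} (hq : q ≤ p j) :
    ∃ y, G.IsAssignment y ∧ G.Consistent y (Function.update p j q) ∧
      (∀ i, x i j ≤ y i j) ∧ ∀ i, 0 < x i j → y i j = G.μ i := by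
  classical
  let best : N → Prop := fun i => ∀ k, k ≠ j → G.v i k - p k ≤ G.v i j - q
  have hbest : ∀ i, 0 < x i j → best i := fun i hi k _ => by linarith [hc i j hi k]
  have hle : ∀ i, x i j ≤ G.μ i := fun i => by
    rw [← hx.2 i]
    exact Finset.single_le_sum (fun k _ => hx.1 i k) (Finset.mem_univ j)
  refine ⟨fun i k => if best i then (if k = j then G.μ i else 0) else x i k,
    ⟨fun i k => ?_, fun i => ?_⟩, fun i k hik l => ?_, fun i => ?_, fun i hi => ?_⟩
  · dsimp only
    split_ifs
    exacts [(G.μ_pos i).le, le_rfl, hx.1 i k]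
  · by_cases hb : best i
    · simp [hb]
    · simp [hb, hx.2 i]
  · by_cases hb : best i
    · have hk : k = j := by
        by_contra hk
        simp [hb, hk] at hik
      subst hk
      by_cases hl : l = k
      · rw [hl]
      · simpa [Function.update_of_ne hl] using hb l hl
    · simp only [hb, if_false] at hik
      have hkj : k ≠ j := fun e => hb (hbest i (e ▸ hik))
      rw [Function.update_of_ne hkj]
      by_cases hl : l = j
      · obtain ⟨m, -, hm⟩ : ∃ m, m ≠ j ∧ G.v i j - q < G.v i m - p m := by
          by_contra! hm
          exact hb hm
        rw [hl, Function.update_self]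
        linarith [hc i k hik m]
      · rw [Function.update_of_ne hl]
        exact hc i k hik l
  · by_cases hb : best i <;> simp [hb, hle i]
  · simp [hbest i hi]

/-- At equilibrium, a vendor sharing the volume of some buyer type with another vendor
prices at cost. -/
theorem IsEquilibrium.price_eq_cost_of_split [DecidableEq M] {G : PCGame N M} {x : N → M → ℝ}
    {p : M → ℝ} (h : G.IsEquilibrium x p) {i : N} {j k : M} (hjk : j ≠ k) (hja : j ≠ G.abstain)
    (hj : 0 < x i j) (hk : 0 < x i k) : p j = G.c j := by
  obtain ⟨hp, hx, hc, hdev⟩ := h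
  refine le_antisymm (not_lt.1 fun hlt => ?_) (hp.1 j)
  set S := ∑ i, x i j with hS
  have hS0 : 0 ≤ S := Finset.sum_nonneg fun i _ => hx.1 i j
  have hd : 0 < p j - G.c j := sub_pos.2 hlt
  obtain ⟨r, hr0, hr⟩ : ∃ r : ℝ, 0 < r ∧ r * (S + x i k) = S + x i k / 2 :=
    ⟨(S + x i k / 2) / (S + x i k), by positivity, by field_simp⟩
  have hr1 : r ≤ 1 := by
    by_contra! hr1
    nlinarith
  obtain ⟨y, hy, hcy, hxy, hyμ⟩ := exists_consistent_of_price_cut hx hc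
    (j := j) (q := G.c j + r * (p j - G.c j)) (by nlinarith)
  have hu := hdev j hja _ (by nlinarith) y hy hcy
  have hyi : x i j + x i k ≤ y i j := by
    rw [hyμ i hj, ← hx.2 i, ← Finset.sum_pair hjk]
    exact Finset.sum_le_sum_of_subset_of_nonneg (Finset.subset_univ _) fun l _ _ => hx.1 i l
  have hY : S + x i k ≤ ∑ l, y l j := by
    have hrest := Finset.single_le_sum (f := fun l => y l j - x l j)
      (fun l _ => sub_nonneg.2 (hxy l)) (Finset.mem_univ i)
    rw [Finset.sum_sub_distrib] at hrest
    linarith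
  simp only [util, Function.update_self, add_sub_cancel_left, ← hS] at hu
  have h1 := mul_le_mul_of_nonneg_left hY (mul_pos hr0 hd).le
  have h2 : r * (p j - G.c j) * (S + x i k) = (p j - G.c j) * (S + x i k / 2) := by
    rw [← hr]; ring
  nlinarith [mul_pos hd hk]

end PCGame

/-- if at equilibrium buyers of a type are split between two distinct
non-abstain vendors, then both vendors price at cost, and merging the split volume
onto one of them preserves consistency, equilibrium and social welfare. -/
theorem stmt2 {N M : Type} [Fintype N] [Fintype M] [DecidableEq N] [DecidableEq M]
    (G : PCGame N M) (x : N → M → ℝ) (p : M → ℝ)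
    (h : G.IsEquilibrium x p)
    (i : N) (j j' : M) (hjj' : j ≠ j')
    (hja : j ≠ G.abstain) (hj'a : j' ≠ G.abstain)
    (hxij : 0 < x i j) (hxij' : 0 < x i j')
    (x' : N → M → ℝ)
    (hx' : x' = fun i' j'' => if i' = i then
      (if j'' = j then x i j + x i j' else if j'' = j' then 0 else x i' j'')
      else x i' j'') :
    p j = G.c j ∧ p j' = G.c j' ∧ G.Consistent x' p ∧ G.IsEquilibrium x' p ∧
      G.SW x' = G.SW x := by
  have hj := h.price_eq_cost_of_split hjj' hja hxij hxij'
  have hj' := h.price_eq_cost_of_split hjj'.symm hj'a hxij' hxij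
  obtain ⟨hp, hx, hc, hdev⟩ := h
  have hx'_eq : ∀ l k, x' l k = x l k +
      if l = i then (if k = j then x i j' else 0) - (if k = j' then x i j' else 0) else 0 := by
    intro l k
    subst hx'
    by_cases hl : l = i
    · subst hl
      by_cases hk : k = j
      · subst hk; simp [hjj']
      · by_cases hk' : k = j'
        · subst hk'; simp [hk]
        · simp [hk, hk']
    · simp [hl]
  have hcons : G.Consistent x' p := by
    intro l k hlk
    apply hc l k
    by_contra hn
    have hn0 : x l k = 0 := le_antisymm (not_lt.1 hn) (hx.1 l k)
    rw [hx'_eq, hn0] at hlk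
    split_ifs at hlk with hl hk hk' hk'
    all_goals first
      | exact hn (by simpa [hl, hk] using hxij)
      | linarith
  have hassign : G.IsAssignment x' := by
    refine ⟨fun l k => ?_, fun l => ?_⟩
    · subst hx'
      dsimp only
      split_ifs
      exacts [by positivity, le_rfl, hx.1 l k, hx.1 l k]
    · simp only [hx'_eq, Finset.sum_add_distrib, hx.2 l]
      by_cases hl : l = i <;> simp [hl]
  have hutil : ∀ k, G.util x' p k = G.util x p k := by
    intro k
    by_cases hk : k = j
    · simp [PCGame.util, hk, hj]
    by_cases hk' : k = j'
    · simp [PCGame.util, hk', hj']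
    · simp [PCGame.util, hx'_eq, hk, hk']
  refine ⟨hj, hj', hcons, ⟨hp, hassign, hcons, fun k hk q hq y hy hcy => ?_⟩, ?_⟩
  · rw [hutil]
    exact hdev k hk q hq y hy hcy
  · have hv : G.v i j - G.c j = G.v i j' - G.c j' := by
      rw [← hj, ← hj']
      exact le_antisymm (hc i j' hxij' j) (hc i j hxij j')
    refine Finset.sum_congr rfl fun l _ => ?_
    simp only [hx'_eq, add_mul, Finset.sum_add_distrib]
    by_cases hl : l = i
    · subst hl
      simp [sub_mul, hv]
    · simp [hl]
end

section
/- Let (x,p) be an equilibrium of a price competition game in which every buyer type is assigned entirely to a single vendor, i.e., x_{i,η(i)} = μ_i for a function η : N → M. Let o : N → M be any function such that for every buyer type i, either o(i) = η(i) or v_{i,o(i)} − c_{o(i)} > v_{i,η(i)} − c_{η(i)}. Then for every buyer type i: t_i(x,p) + u_{o(i)}(x,p) ≥ μ_i·(v_{i,o(i)} − c_{o(i)}). -/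
open Finset

/-- key inequality of the price-of-anarchy upper bound. -/
theorem stmt3 {N M : Type} [Fintype N] [Fintype M] [DecidableEq M]
    (G : PCGame N M) (x : N → M → ℝ) (p : M → ℝ)
    (h : G.IsEquilibrium x p)
    (η o : N → M)
    (hη : ∀ i, x i (η i) = G.μ i)
    (ho : ∀ i, o i = η i ∨ G.v i (η i) - G.c (η i) < G.v i (o i) - G.c (o i)) :
    ∀ i, G.μ i * (G.v i (o i) - G.c (o i)) ≤ G.buyerUtil x p i + G.util x p (o i) := by
  classical
  obtain ⟨⟨hpc, hpa⟩, ⟨hx0, hxs⟩, hcons, hdev⟩ := h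
  intro i
  have hbest : ∀ j, G.v i j - p j ≤ G.v i (η i) - p (η i) :=
    hcons i (η i) (by rw [hη]; exact G.μ_pos i)
  have hzero : ∀ j, j ≠ η i → x i j = 0 := by
    have hrest : ∑ j ∈ univ.erase (η i), x i j = 0 := by
      have := add_sum_erase univ (x i) (mem_univ (η i))
      rw [hxs i, hη i] at this
      linarith
    intro j hj
    exact (sum_eq_zero_iff_of_nonneg fun j _ => hx0 i j).1 hrest j
      (mem_erase.2 ⟨hj, mem_univ j⟩)
  have hbuyer : G.buyerUtil x p i = G.μ i * (G.v i (η i) - p (η i)) := by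
    unfold PCGame.buyerUtil
    rw [sum_eq_single (η i) (fun j _ hj => by rw [hzero j hj, zero_mul]) (by simp), hη]
  have hμ := G.μ_pos i
  rw [hbuyer]
  by_cases heq : o i = η i
  · rw [heq]
    have hvol : G.μ i ≤ ∑ k, x k (η i) := by
      rw [← hη i]
      exact single_le_sum (f := fun k => x k (η i)) (fun k _ => hx0 k _) (mem_univ i)
    have := mul_le_mul_of_nonneg_left hvol (sub_nonneg.2 (hpc (η i)))
    unfold PCGame.util
    linarith
  by_cases hle : G.v i (o i) - G.c (o i) ≤ G.v i (η i) - p (η i)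
  · have hutil : 0 ≤ G.util x p (o i) :=
      mul_nonneg (sub_nonneg.2 (hpc _)) (sum_nonneg fun k _ => hx0 k _)
    have := mul_le_mul_of_nonneg_left hle hμ.le
    linarith
  push Not at hle
  have hna : o i ≠ G.abstain := by
    intro ha
    have := hbest (o i)
    rw [ha] at this hle
    rw [G.c_abstain] at hle
    rw [hpa] at this
    linarith
  -- The price at which vendor `o i` ties with `η i` for buyer type `i`.
  let p' : ℝ := G.v i (o i) - (G.v i (η i) - p (η i))
  have hp' : G.c (o i) ≤ p' := by
    change G.c (o i) ≤ G.v i (o i) - (G.v i (η i) - p (η i))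
    linarith
  let q := Function.update p (o i) p'
  have hmax : ∀ k, ∃ j, ∀ j', G.v k j' - q j' ≤ G.v k j - q j := by
    intro k
    have : Nonempty M := ⟨G.abstain⟩
    exact Finite.exists_max fun j => G.v k j - q j
  choose b hb using hmax
  have hoi : ∀ j', G.v i j' - q j' ≤ G.v i (o i) - q (o i) := by
    intro j'
    by_cases hj : j' = o i
    · rw [hj]
    · have := hbest j'
      simp only [q, p', Function.update_self, Function.update_of_ne hj]
      linarith
  let f := Function.update b i (o i)
  have hf : ∀ k j', G.v k j' - q j' ≤ G.v k (f k) - q (f k) := by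
    intro k
    by_cases hk : k = i
    · subst hk
      simpa only [f, Function.update_self] using hoi
    · simpa only [f, Function.update_of_ne hk] using hb k
  let y : N → M → ℝ := fun k j => if j = f k then G.μ k else 0
  have hy0 : ∀ k j, 0 ≤ y k j := by
    intro k j
    simp only [y]
    split_ifs
    exacts [(G.μ_pos k).le, le_rfl]
  have hya : G.IsAssignment y := ⟨hy0, fun k => by simp [y]⟩
  have hyc : G.Consistent y q := by
    intro k j hpos
    have hj : j = f k := by
      by_contra hne
      simp [y, hne] at hpos
    rw [hj]
    exact hf k
  have hu := hdev (o i) hna p' hp' y hya hyc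
  have hvol : G.μ i ≤ ∑ k, y k (o i) := by
    have : y i (o i) = G.μ i := by simp [y, f]
    rw [← this]
    exact single_le_sum (f := fun k => y k (o i)) (fun k _ => hy0 k _) (mem_univ i)
  have hgain := mul_le_mul_of_nonneg_left hvol (sub_nonneg.2 hp')
  simp only [PCGame.util, Function.update_self] at hu ⊢
  have hexp : (p' - G.c (o i)) * G.μ i =
      G.μ i * (G.v i (o i) - G.c (o i)) - G.μ i * (G.v i (η i) - p (η i)) := by
    simp only [p']
    ring
  linarith
end

section
/- Every price competition game with exactly one buyer type admits an equilibrium. In particular, writing v_j for the valuation of the single buyer type for vendor j, if j* is a non-abstain vendor maximizing v_j − c_j over all vendors (the abstain vendor included) and j' maximizes v_j − c_j over M \ {j*}, then the price vector with p_{j*} = v_{j*} − v_{j'} + c_{j'} and p_j = c_j for every vendor j ≠ j*, together with the assignment placing all buyers at vendor j*, is an equilibrium. -/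
open Finset

namespace PCGame

/-- With a single buyer type, placing all buyers at a vendor `k` they prefer is an equilibrium if
no other vendor can profitably attract them and `k` (unless it abstains) has no room to raise its
price. -/
theorem isEquilibrium_of_all_at {M : Type} [Fintype M] [DecidableEq M] (G : PCGame Unit M)
    (p : M → ℝ) (k : M) (hp : G.IsPrice p)
    (hmax : ∀ j, G.v () j - p j ≤ G.v () k - p k)
    (hother : ∀ j, j ≠ k → G.v () j - G.c j ≤ G.v () k - p k)
    (htight : k ≠ G.abstain → ∃ l, l ≠ k ∧ G.v () k - p k ≤ G.v () l - p l) :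
    G.IsEquilibrium (fun _ j => if j = k then G.μ () else 0) p := by
  have hμ : 0 < G.μ () := G.μ_pos ()
  refine ⟨hp, ⟨fun i j => ?_, fun i => by simp⟩, fun i j hj j' => ?_, ?_⟩
  · dsimp only
    split_ifs
    exacts [hμ.le, le_rfl]
  · have hjk : j = k := by
      by_contra h
      simp [h] at hj
    exact hjk ▸ hmax j'
  · intro j hj q hq y hy hc
    have hy0 : 0 ≤ y () j := hy.1 () j
    have hyμ : y () j ≤ G.μ () :=
      hy.2 () ▸ Finset.single_le_sum (fun l _ => hy.1 () l) (Finset.mem_univ j)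
    simp only [util, Function.update_self, Finset.univ_unique, Finset.sum_singleton,
      PUnit.default_eq_unit]
    rcases hy0.eq_or_lt with h0 | hpos
    · rw [← h0, mul_zero]
      refine mul_nonneg (sub_nonneg.2 (hp.1 j)) ?_
      split_ifs
      exacts [hμ.le, le_rfl]
    · have hbest := hc () j hpos
      by_cases hjk : j = k
      · subst hjk
        obtain ⟨l, hl, hle⟩ := htight hj
        have hl' := hbest l
        rw [Function.update_self, Function.update_of_ne hl] at hl'
        rw [if_pos rfl]
        exact mul_le_mul (by linarith) hyμ hy0 (sub_nonneg.2 (hp.1 j))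
      · have hk := hbest k
        rw [Function.update_self, Function.update_of_ne (Ne.symm hjk)] at hk
        rw [if_neg hjk, mul_zero]
        exact mul_nonpos_of_nonpos_of_nonneg (by linarith [hother j hjk]) hy0

end PCGame

/-- every price competition game with one buyer type admits an
equilibrium; in particular the explicit construction is an equilibrium. -/
theorem stmt4 {M : Type} [Fintype M] [DecidableEq M] (G : PCGame Unit M) :
    (∃ (x : Unit → M → ℝ) (p : M → ℝ), G.IsEquilibrium x p) ∧
      (∀ jstar j' : M, jstar ≠ G.abstain →
        (∀ j, G.v () j - G.c j ≤ G.v () jstar - G.c jstar) →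
        j' ≠ jstar →
        (∀ j, j ≠ jstar → G.v () j - G.c j ≤ G.v () j' - G.c j') →
        G.IsEquilibrium (fun _ j => if j = jstar then G.μ () else 0)
          (fun j => if j = jstar then G.v () jstar - G.v () j' + G.c j' else G.c j)) := by
  have key : ∀ jstar j' : M, jstar ≠ G.abstain →
      (∀ j, G.v () j - G.c j ≤ G.v () jstar - G.c jstar) →
      j' ≠ jstar →
      (∀ j, j ≠ jstar → G.v () j - G.c j ≤ G.v () j' - G.c j') →
      G.IsEquilibrium (fun _ j => if j = jstar then G.μ () else 0)
        (fun j => if j = jstar then G.v () jstar - G.v () j' + G.c j' else G.c j) := by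
    intro jstar j' hs hmax hne hsecond
    refine G.isEquilibrium_of_all_at _ jstar ⟨fun j => ?_, ?_⟩ (fun j => ?_) (fun j hj => ?_)
      fun _ => ⟨j', hne, ?_⟩
    · dsimp only
      split_ifs with h
      · subst h
        linarith [hmax j']
      · exact le_rfl
    · simp [hs.symm, G.c_abstain]
    · by_cases h : j = jstar
      · rw [h]
      · simp only [h, if_true, if_false]
        linarith [hsecond j h]
    · simp only [if_true]
      linarith [hsecond j hj]
    · simp only [hne, if_true, if_false]
      linarith
  refine ⟨?_, key⟩
  by_cases hall : ∀ j, G.v () j - G.c j ≤ 0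
  · have h0 : G.v () G.abstain - G.c G.abstain = 0 := by rw [G.v_abstain, G.c_abstain, sub_zero]
    exact ⟨_, G.c, G.isEquilibrium_of_all_at G.c G.abstain ⟨fun _ => le_rfl, G.c_abstain⟩
      (fun j => h0 ▸ hall j) (fun j _ => h0 ▸ hall j) fun h => absurd rfl h⟩
  · push Not at hall
    obtain ⟨i, hi⟩ := hall
    obtain ⟨jstar, -, hmax⟩ := Finset.exists_max_image Finset.univ
      (fun j => G.v () j - G.c j) ⟨i, Finset.mem_univ i⟩
    have hs : jstar ≠ G.abstain := by
      rintro rfl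
      have := hmax i (Finset.mem_univ i)
      rw [G.v_abstain, G.c_abstain] at this
      linarith
    obtain ⟨j', hj', hsecond⟩ := Finset.exists_max_image (Finset.univ.erase jstar)
      (fun j => G.v () j - G.c j)
      ⟨G.abstain, Finset.mem_erase.2 ⟨hs.symm, Finset.mem_univ _⟩⟩
    exact ⟨_, _, key jstar j' hs (fun j => hmax j (Finset.mem_univ j)) (Finset.ne_of_mem_erase hj')
      fun j hj => hsecond j (Finset.mem_erase.2 ⟨hj, Finset.mem_univ j⟩)⟩
end

section
/- Fix a price competition game and an assignment x. Call a vendor j empty if ∑_{i∈N} x_{ij} = 0. Let H be the directed graph on the vendors with an edge from j to j' (j ≠ j') labelled i whenever x_{ij} > 0 and v_{ij} − c_j ≤ v_{ij'} − c_{j'}. Let Z (the seed vendors) be the smallest set of vendors such that: every empty vendor is in Z; every vendor j with min_{i : x_{ij}>0} v_{ij} = c_j is in Z; every vendor lying on a directed cycle of H is in Z; and every vendor having a directed edge in H to a vendor of Z is in Z. Define the price vector p by p_j = c_j for every j ∈ Z, and for every j ∉ Z: p_j = min_{i : x_{ij}>0} v_{ij} if Z = ∅, and p_j = min_{i : x_{ij}>0}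 ( v_{ij} − max_{j'∈Z} max{0, v_{ij'} − c_{j'}} ) otherwise. Then: if the game admits an equilibrium (x,q) for some price vector q to which x is consistent, then q_j = p_j for every non-empty vendor j. -/
open Finset

/-- An edge of the directed graph `H`: an edge from `j` to `j'` (with `j ≠ j'`)
labelled by a buyer type `i` with `x i j > 0` and `v i j - c j ≤ v i j' - c j'`. -/
def PCGame.HEdge {N M : Type} [Fintype N] [Fintype M] (G : PCGame N M)
    (x : N → M → ℝ) (j j' : M) : Prop :=
  j ≠ j' ∧ ∃ i, 0 < x i j ∧ G.v i j - G.c j ≤ G.v i j' - G.c j'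

/-- The set `Z` of seed vendors: the smallest set of vendors containing every empty
vendor, every vendor whose minimum valuation among assigned buyers equals its cost,
every vendor lying on a directed cycle of `H`, and every vendor with an `H`-edge to
a seed vendor. -/
inductive PCGame.Seed {N M : Type} [Fintype N] [Fintype M] (G : PCGame N M)
    (x : N → M → ℝ) : M → Prop where
  | empty (j : M) : (∑ i, x i j) = 0 → PCGame.Seed G x j
  | minAtCost (j : M) : (∃ i, 0 < x i j ∧ G.v i j = G.c j) →
      (∀ i, 0 < x i j → G.c j ≤ G.v i j) → PCGame.Seed G x j
  | cycle (j : M) : Relation.TransGen (G.HEdge x) j j → PCGame.Seed G x j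
  | toSeed (j j' : M) : G.HEdge x j j' → PCGame.Seed G x j' → PCGame.Seed G x j

namespace PCGame

variable {N M : Type} [Fintype N] [Fintype M]
  {G : PCGame N M} {x : N → M → ℝ} {q : M → ℝ}

theorem IsAssignment.le_volume_s6 (hx : G.IsAssignment x) (i : N) (j : M) :
    x i j ≤ G.μ i :=
  hx.2 i ▸ Finset.single_le_sum (fun k _ => hx.1 i k) (Finset.mem_univ j)

theorem IsAssignment.add_le_volume (hx : G.IsAssignment x) (i : N) {j k : M} (hjk : j ≠ k) :
    x i j + x i k ≤ G.μ i := by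
  classical
  rw [← hx.2 i, ← Finset.sum_pair hjk]
  exact Finset.sum_le_sum_of_subset_of_nonneg (Finset.subset_univ _) fun m _ _ => hx.1 i m

theorem seed_abstain (hx : G.IsAssignment x) : Seed G x G.abstain := by
  by_cases h0 : ∑ i, x i G.abstain = 0
  · exact .empty _ h0
  obtain ⟨i, -, hi⟩ := Finset.exists_ne_zero_of_sum_ne_zero h0
  exact .minAtCost _ ⟨i, (hx.1 i _).lt_of_ne hi.symm, by rw [G.v_abstain, G.c_abstain]⟩
    fun k _ => by rw [G.v_abstain, G.c_abstain]

variable [DecidableEq M]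

open Classical in
/-- A vendor does not gain by lowering its price to `p'` and serving every buyer type that then
weakly prefers it. -/
theorem IsEquilibrium.undercut_le (h : G.IsEquilibrium x q) {j : M} (hj : j ≠ G.abstain)
    {p' : ℝ} (hc : G.c j ≤ p') (hp : p' ≤ q j) :
    (p' - G.c j) * ∑ i, (if ∀ k, G.v i k - q k ≤ G.v i j - p' then G.μ i else x i j) ≤
      (q j - G.c j) * ∑ i, x i j := by
  obtain ⟨-, hx, hcons, hdev⟩ := h
  let y : N → M → ℝ := fun i k =>
    if ∀ m, G.v i m - q m ≤ G.v i j - p' then (if k = j then G.μ i else 0) else x i k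
  have hy : G.IsAssignment y := by
    refine ⟨fun i k => ?_, fun i => ?_⟩
    · simp only [y]
      split_ifs
      · exact (G.μ_pos i).le
      · exact le_rfl
      · exact hx.1 i k
    · simp only [y]
      split_ifs
      · simp
      · exact hx.2 i
  have hyc : G.Consistent y (Function.update q j p') := by
    intro i k hk m
    simp only [y] at hk
    split_ifs at hk with hT hkj
    · subst hkj
      by_cases hm : m = k
      · simp [hm]
      · simpa [hm] using hT m
    · exact absurd hk (lt_irrefl _)
    · have hbest := hcons i k hk
      obtain ⟨n, hn⟩ := not_forall.1 hT
      have hkj : k ≠ j := by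
        rintro rfl
        linarith [hbest n]
      rw [Function.update_of_ne hkj]
      by_cases hm : m = j
      · subst hm
        rw [Function.update_self]
        linarith [hbest n]
      · rw [Function.update_of_ne hm]
        exact hbest m
  simpa [util, y] using hdev j hj p' hc y hy hyc

theorem IsEquilibrium.price_eq_cost_of_tie (h : G.IsEquilibrium x q) {i : N} {j k : M}
    (hjk : j ≠ k) (hi : 0 < x i j) (htie : G.v i j - q j = G.v i k - q k) : q k = G.c k := by
  classical
  by_cases hk : k = G.abstain
  · rw [hk, h.1.2, G.c_abstain]
  refine ((h.1.1 k).eq_of_not_lt fun hlt => ?_).symm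
  have hx := h.2.1
  have hle := le_of_mul_le_mul_left (h.undercut_le hk (h.1.1 k) le_rfl) (sub_pos.2 hlt)
  refine hle.not_gt (Finset.sum_lt_sum (fun l _ => ?_) ⟨i, Finset.mem_univ i, ?_⟩)
  · split_ifs
    · exact hx.le_volume_s6 l k
    · exact le_rfl
  · rw [if_pos fun m => htie ▸ h.2.2.1 i j hi m]
    linarith [hx.add_le_volume i hjk]

theorem IsEquilibrium.value_le_of_empty (h : G.IsEquilibrium x q) {k : M}
    (hk : ∑ i, x i k = 0) {i : N} {j : M} (hi : 0 < x i j) :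
    G.v i k - G.c k ≤ G.v i j - q j := by
  classical
  have hbest := h.2.2.1 i j hi
  by_cases hka : k = G.abstain
  · subst hka
    simpa [h.1.2, G.c_abstain] using hbest G.abstain
  by_contra! hlt
  have hdev := h.undercut_le hka (p' := G.v i k - (G.v i j - q j)) (by linarith)
    (by linarith [hbest k])
  rw [hk, mul_zero] at hdev
  refine hdev.not_gt (mul_pos (by linarith)
    (Finset.sum_pos' (fun l _ => ?_) ⟨i, Finset.mem_univ i, ?_⟩))
  · split_ifs
    · exact (G.μ_pos l).le
    · exact h.2.1.1 l k
  · rw [if_pos fun m => by linarith [hbest m]]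
    exact G.μ_pos i

open Filter Topology in
/-- Some buyer type of a non-empty vendor is indifferent between it and another vendor. -/
theorem IsEquilibrium.exists_tie (h : G.IsEquilibrium x q) {j : M} (hj : j ≠ G.abstain)
    (hne : ∑ i, x i j ≠ 0) :
    ∃ i k, 0 < x i j ∧ j ≠ k ∧ G.v i j - q j = G.v i k - q k := by
  obtain ⟨hq, hx, hcons, hdev⟩ := h
  by_contra! hno
  have hev : ∀ᶠ p' in 𝓝[>] q j, ∀ i k, 0 < x i j → j ≠ k → G.v i k - q k ≤ G.v i j - p' := by
    simp only [eventually_all]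
    intro i k hi hjk
    have hlt : q j < G.v i j - (G.v i k - q k) := by
      linarith [(hcons i j hi k).lt_of_ne (hno i k hi hjk).symm]
    filter_upwards [nhdsWithin_le_nhds (eventually_lt_nhds hlt)] with p' hp'
    linarith
  obtain ⟨p', hstay, hp'⟩ := (hev.and self_mem_nhdsWithin).exists
  have hp' : q j < p' := hp'
  have hyc : G.Consistent x (Function.update q j p') := by
    intro i k hk m
    by_cases hkj : k = j
    · subst hkj
      by_cases hm : m = k
      · rw [hm]
      · simpa [hm] using hstay i m hk (Ne.symm hm)
    · rw [Function.update_of_ne hkj]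
      by_cases hm : m = j
      · subst hm
        rw [Function.update_self]
        linarith [hcons i k hk m]
      · rw [Function.update_of_ne hm]
        exact hcons i k hk m
  have hle := hdev j hj p' ((hq.1 j).trans hp'.le) x hx hyc
  simp only [util, Function.update_self] at hle
  have hpos : 0 < ∑ i, x i j := (Finset.sum_nonneg fun i _ => hx.1 i j).lt_of_ne hne.symm
  linarith [le_of_mul_le_mul_right hle hpos]

/-- Along an edge of `H` out of a vendor priced above cost, the margin strictly increases. -/
theorem IsEquilibrium.margin_lt_of_hEdge (h : G.IsEquilibrium x q) {j k : M}
    (he : G.HEdge x j k) (hj : G.c j < q j) : q j - G.c j < q k - G.c k := by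
  obtain ⟨hjk, i, hi, hv⟩ := he
  have hbest := h.2.2.1 i j hi k
  by_contra! hle
  linarith [h.price_eq_cost_of_tie hjk hi (by linarith)]

theorem IsEquilibrium.margin_lt_of_transGen (h : G.IsEquilibrium x q) {j k : M}
    (he : Relation.TransGen (G.HEdge x) j k) (hj : G.c j < q j) :
    q j - G.c j < q k - G.c k := by
  induction he with
  | single he => exact h.margin_lt_of_hEdge he hj
  | tail _ he ih => exact ih.trans (h.margin_lt_of_hEdge he (by linarith))

theorem IsEquilibrium.value_le_of_price_eq_cost (h : G.IsEquilibrium x q) {k : M}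
    (hk : ∑ i, x i k ≠ 0 → q k = G.c k) {i : N} {j : M} (hi : 0 < x i j) :
    G.v i k - G.c k ≤ G.v i j - q j := by
  by_cases hne : ∑ i, x i k = 0
  · exact h.value_le_of_empty hne hi
  · exact hk hne ▸ h.2.2.1 i j hi k

theorem IsEquilibrium.price_eq_cost_of_seed (h : G.IsEquilibrium x q) {j : M}
    (hj : Seed G x j) (hne : ∑ i, x i j ≠ 0) : q j = G.c j := by
  refine le_antisymm ?_ (h.1.1 j)
  induction hj with
  | empty j h0 => exact absurd h0 hne
  | minAtCost j hmin _ =>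
    obtain ⟨i, hi, hv⟩ := hmin
    have := h.2.2.1 i j hi G.abstain
    rw [G.v_abstain, h.1.2] at this
    linarith
  | cycle j hcyc =>
    by_contra! hlt
    exact lt_irrefl _ (h.margin_lt_of_transGen hcyc hlt)
  | toSeed j k he _ ih =>
    obtain ⟨-, i, hi, hv⟩ := he
    linarith [h.value_le_of_price_eq_cost (fun hk => (ih hk).antisymm (h.1.1 k)) hi]

/-- Non-seed vendors are priced above cost: otherwise one could follow ties along an infinite path
in the acyclic part of `H`. -/
theorem IsEquilibrium.price_ne_cost_of_not_seed (h : G.IsEquilibrium x q) {j : M}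
    (hj : ¬ Seed G x j) : q j ≠ G.c j := by
  let r : M → M → Prop := fun a b => Relation.TransGen (G.HEdge x) b a ∧ ¬ Seed G x b
  have : IsTrans M r := ⟨fun a b c hab hbc => ⟨hbc.1.trans hab.1, hbc.2⟩⟩
  have : Std.Irrefl r := ⟨fun a ha => ha.2 (.cycle a ha.1)⟩
  induction j using (Finite.wellFounded_of_trans_of_irrefl r).induction with
  | _ j ih =>
    intro hqj
    have hja : j ≠ G.abstain := fun e => hj (e ▸ seed_abstain h.2.1)
    obtain ⟨i, k, hi, hjk, htie⟩ := h.exists_tie hja fun h0 => hj (.empty j h0)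
    have he : G.HEdge x j k := ⟨hjk, i, hi, by linarith [h.1.1 k]⟩
    exact ih k ⟨.single he, hj⟩ (fun hk => hj (.toSeed j k he hk))
      (h.price_eq_cost_of_tie hjk hi htie)

theorem IsEquilibrium.price_eq_of_not_seed (h : G.IsEquilibrium x q) {j : M}
    (hj : ¬ Seed G x j) :
    q j = sInf {r : ℝ | ∃ i, 0 < x i j ∧
      r = G.v i j - sSup {s : ℝ | ∃ k, Seed G x k ∧ s = max 0 (G.v i k - G.c k)}} := by
  have hseed := seed_abstain h.2.1
  let S : N → Set ℝ := fun i => {s | ∃ k, Seed G x k ∧ s = max 0 (G.v i k - G.c k)}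
  have hle : ∀ i, 0 < x i j → ∀ s ∈ S i, s ≤ G.v i j - q j := by
    rintro i hi _ ⟨k, hk, rfl⟩
    refine max_le ?_ (h.value_le_of_price_eq_cost (h.price_eq_cost_of_seed hk) hi)
    simpa [G.v_abstain, h.1.2] using h.2.2.1 i j hi G.abstain
  have hsup : ∀ i, 0 < x i j → sSup (S i) ≤ G.v i j - q j := fun i hi =>
    csSup_le ⟨_, G.abstain, hseed, rfl⟩ (hle i hi)
  have hja : j ≠ G.abstain := fun e => hj (e ▸ hseed)
  obtain ⟨i, k, hi, hjk, htie⟩ := h.exists_tie hja fun h0 => hj (.empty j h0)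
  have hqk := h.price_eq_cost_of_tie hjk hi htie
  have hk : Seed G x k := by
    by_contra hk
    exact h.price_ne_cost_of_not_seed hk hqk
  have hmem : max 0 (G.v i k - G.c k) ≤ sSup (S i) :=
    le_csSup ⟨_, hle i hi⟩ ⟨k, hk, rfl⟩
  refine Eq.symm (IsLeast.csInf_eq ⟨⟨i, hi, ?_⟩, ?_⟩)
  · change q j = G.v i j - sSup (S i)
    linarith [hsup i hi, le_max_right 0 (G.v i k - G.c k)]
  · rintro _ ⟨l, hl, rfl⟩
    change q j ≤ G.v l j - sSup (S l)
    linarith [hsup l hl]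

end PCGame

/-- correctness of `CandidatePrice`: if the game admits an equilibrium
`(x, q)` then `q` agrees on all non-empty vendors with the candidate price vector `p`. -/
theorem stmt6 {N M : Type} [Fintype N] [Fintype M] [DecidableEq M]
    (G : PCGame N M) (x : N → M → ℝ) (hx : G.IsAssignment x)
    (p : M → ℝ)
    (hpZ : ∀ j, PCGame.Seed G x j → p j = G.c j)
    (hpNoSeed : (∀ j', ¬ PCGame.Seed G x j') →
      ∀ j, p j = sInf {r : ℝ | ∃ i, 0 < x i j ∧ r = G.v i j})
    (hpSomeSeed : (∃ j₀, PCGame.Seed G x j₀) → ∀ j, ¬ PCGame.Seed G x j →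
      p j = sInf {r : ℝ | ∃ i, 0 < x i j ∧
        r = G.v i j - sSup {s : ℝ | ∃ j', PCGame.Seed G x j' ∧
          s = max 0 (G.v i j' - G.c j')}}) :
    ∀ q : M → ℝ, G.IsEquilibrium x q → ∀ j, (∑ i, x i j) ≠ 0 → q j = p j := by
  intro q hq j hne
  by_cases hj : PCGame.Seed G x j
  · rw [hpZ j hj, hq.price_eq_cost_of_seed hj hne]
  · rw [hpSomeSeed ⟨_, PCGame.seed_abstain hx⟩ j hj, hq.price_eq_of_not_seed hj]
end

section
/- Let (x,q) be an equilibrium of a price competition game and define the price vector q' by q'_j = c_j for every vendor j with ∑_{i∈N} x_{ij} = 0 (the empty vendors) and q'_j = q_j for every other vendor. Then x is consistent to q' and (x,q') is also an equilibrium. -/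
open Finset

/-- Some consistent assignment sends to `j` every buyer type for which `j` is optimal. -/
theorem PCGame.exists_consistent_favoring {N M : Type} [Fintype N] [Fintype M]
    (G : PCGame N M) (p : M → ℝ) (j : M) :
    ∃ y, G.IsAssignment y ∧ G.Consistent y p ∧
      ∀ i, (∀ k, G.v i k - p k ≤ G.v i j - p j) → y i j = G.μ i := by
  classical
  have hbest : ∀ i, ∃ m, (∀ k, G.v i k - p k ≤ G.v i m - p m) ∧
      ((∀ k, G.v i k - p k ≤ G.v i j - p j) → m = j) := by
    intro i
    by_cases hj : ∀ k, G.v i k - p k ≤ G.v i j - p j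
    · exact ⟨j, hj, fun _ => rfl⟩
    · have : Nonempty M := ⟨j⟩
      obtain ⟨m, hm⟩ := Finite.exists_max fun k => G.v i k - p k
      exact ⟨m, hm, fun h => absurd h hj⟩
  choose f hf hfj using hbest
  refine ⟨fun i k => if k = f i then G.μ i else 0, ⟨fun i k => ?_, fun i => ?_⟩, ?_, ?_⟩
  · dsimp only
    split_ifs
    · exact (G.μ_pos i).le
    · exact le_rfl
  · simp
  · intro i k hk
    dsimp only at hk
    split_ifs at hk with hkf
    · exact hkf ▸ hf i
    · exact absurd hk (lt_irrefl 0)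
  · intro i hi
    simp [hfj i hi]

/-- In an equilibrium, a buyer type cannot strictly gain from an empty vendor selling at cost. -/
theorem PCGame.IsEquilibrium.sub_cost_le_of_empty {N M : Type} [Fintype N] [Fintype M]
    [DecidableEq M] {G : PCGame N M} {x : N → M → ℝ} {q : M → ℝ} (h : G.IsEquilibrium x q)
    {i : N} {j k : M} (hij : 0 < x i j) (hk : ∑ i, x i k = 0) :
    G.v i k - G.c k ≤ G.v i j - q j := by
  obtain ⟨⟨_, hq0⟩, _, hcons, hdev⟩ := h
  by_contra! hlt
  have hka : k ≠ G.abstain := by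
    rintro rfl
    have := hcons i j hij G.abstain
    rw [hq0] at this
    rw [G.c_abstain] at hlt
    linarith
  obtain ⟨r, hcr, hr⟩ := exists_between (show G.c k < G.v i k - (G.v i j - q j) by linarith)
  obtain ⟨y, hy, hyc, hyk⟩ := G.exists_consistent_favoring (Function.update q k r) k
  have hik : y i k = G.μ i := by
    refine hyk i fun m => ?_
    rcases eq_or_ne m k with rfl | hm
    · exact le_rfl
    · have := hcons i j hij m
      rw [Function.update_of_ne hm, Function.update_self]
      linarith
  have hpos : 0 < ∑ i, y i k :=
    Finset.sum_pos' (fun i _ => hy.1 i k) ⟨i, Finset.mem_univ i, hik ▸ G.μ_pos i⟩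
  have hle := hdev k hka r hcr.le y hy hyc
  simp only [PCGame.util, Function.update_self, hk, mul_zero] at hle
  exact absurd hle (not_le.mpr (mul_pos (sub_pos.mpr hcr) hpos))

/-- Raising the prices of the competitors of `j` cannot lower the best utility of `j`
at a fixed price. -/
theorem PCGame.exists_consistent_util_ge {N M : Type} [Fintype N] [Fintype M]
    [DecidableEq M] (G : PCGame N M) {p q : M → ℝ} (hpq : p ≤ q) {j : M} {r : ℝ}
    (hr : G.c j ≤ r) {y : N → M → ℝ} (hy : G.IsAssignment y)
    (hyc : G.Consistent y (Function.update p j r)) :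
    ∃ z, G.IsAssignment z ∧ G.Consistent z (Function.update q j r) ∧
      G.util y (Function.update p j r) j ≤ G.util z (Function.update q j r) j := by
  obtain ⟨z, hz, hzc, hzj⟩ := G.exists_consistent_favoring (Function.update q j r) j
  refine ⟨z, hz, hzc, ?_⟩
  simp only [PCGame.util, Function.update_self]
  refine mul_le_mul_of_nonneg_left (Finset.sum_le_sum fun i _ => ?_) (sub_nonneg.mpr hr)
  rcases (hy.1 i j).eq_or_lt with h0 | hpos
  · exact h0 ▸ hz.1 i j
  · have hopt : ∀ k, G.v i k - Function.update q j r k ≤ G.v i j - Function.update q j r j := by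
      intro k
      have hle := hyc i j hpos k
      have hupd : Function.update p j r k ≤ Function.update q j r k :=
        update_le_update_iff.mpr ⟨le_rfl, fun m _ => hpq m⟩ k
      simp only [Function.update_self] at hle ⊢
      linarith
    rw [hzj i hopt, ← hy.2 i]
    exact Finset.single_le_sum (fun k _ => hy.1 i k) (Finset.mem_univ j)

/-- dropping the prices of empty vendors to their production costs
preserves consistency and equilibrium. -/
theorem stmt7 {N M : Type} [Fintype N] [Fintype M] [DecidableEq M]
    (G : PCGame N M) (x : N → M → ℝ) (q : M → ℝ)
    (h : G.IsEquilibrium x q)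
    (q' : M → ℝ)
    (hq' : q' = fun j => if (∑ i, x i j) = 0 then G.c j else q j) :
    G.Consistent x q' ∧ G.IsEquilibrium x q' := by
  subst hq'
  have hcons : G.Consistent x (fun j => if (∑ i, x i j) = 0 then G.c j else q j) := by
    intro i j hij k
    have hj : ∑ i, x i j ≠ 0 :=
      (Finset.sum_pos' (fun i _ => h.2.1.1 i j) ⟨i, Finset.mem_univ i, hij⟩).ne'
    simp only [if_neg hj]
    split_ifs with hk
    · exact h.sub_cost_le_of_empty hij hk
    · exact h.2.2.1 i j hij k
  refine ⟨hcons, ⟨fun j => ?_, ?_⟩, h.2.1, hcons, fun j hj r hr y hy hyc => ?_⟩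
  · dsimp only
    split_ifs
    · exact le_rfl
    · exact h.1.1 j
  · simp [G.c_abstain, h.1.2]
  · have hle : (fun j => if (∑ i, x i j) = 0 then G.c j else q j) ≤ q := by
      intro k
      dsimp only
      split_ifs
      · exact h.1.1 k
      · exact le_rfl
    obtain ⟨z, hz, hzc, hyz⟩ := G.exists_consistent_util_ge hle hr hy hyc
    refine (hyz.trans (h.2.2.2 j hj r hr z hz hzc)).trans_eq ?_
    simp only [PCGame.util]
    split_ifs with h0
    · simp [h0]
    · rfl
end

section
/- Let (x,q) be an equilibrium of a price competition game. Suppose there are ℓ ≥ 2 distinct vendors j_1, …, j_ℓ and buyer types i_1, …, i_ℓ such that, with indices taken modulo ℓ, for every k it holds that x_{i_k, j_k} > 0 and v_{i_k, j_k} − c_{j_k} ≤ v_{i_k, j_{k+1}} − c_{j_{k+1}}. Then q_{j_k} = c_{j_k} for every k, and moreover v_{i_k, j_k} − q_{j_k} = v_{i_k, j_{k+1}} − q_{j_{k+1}} for every k. -/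
open Finset

namespace PCGame

variable {N M : Type} [Fintype N] [Fintype M]

/-- If vendor `b` lowers its price, moving every buyer type for which `b` is now optimal entirely
to `b` yields a valid assignment that is consistent to the new prices. -/
theorem exists_consistent_of_price_le [DecidableEq M] {G : PCGame N M} {x : N → M → ℝ}
    {q : M → ℝ} (hx : G.IsAssignment x) (hc : G.Consistent x q) (b : M) {p : ℝ} (hp : p ≤ q b) :
    ∃ y, G.IsAssignment y ∧ G.Consistent y (Function.update q b p) ∧
      (∀ i, x i b ≤ y i b) ∧
      ∀ i, (∀ j, G.v i j - q j ≤ G.v i b - q b) → y i b = G.μ i := by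
  classical
  have hle : ∀ i j, x i j ≤ G.μ i := fun i j => by
    rw [← hx.2 i]
    exact single_le_sum (fun k _ => hx.1 i k) (mem_univ j)
  refine ⟨fun i => if ∀ j, j ≠ b → G.v i j - q j ≤ G.v i b - p then
    Pi.single b (G.μ i) else x i, ⟨fun i j => ?_, fun i => ?_⟩, fun i j hij k => ?_,
    fun i => ?_, fun i hi => ?_⟩
  · dsimp only
    split_ifs
    · obtain rfl | hj := eq_or_ne j b
      · simpa using (G.μ_pos i).le
      · simp [hj]
    · exact hx.1 i j
  · dsimp only
    split_ifs
    · simp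
    · exact hx.2 i
  · dsimp only at hij
    split_ifs at hij with h
    · obtain rfl | hj := eq_or_ne j b
      · obtain rfl | hk := eq_or_ne k j
        · rfl
        · simpa [hk] using h k hk
      · simp [hj] at hij
    · push Not at h
      obtain ⟨m, hm, hlt⟩ := h
      have hjm := hc i j hij m
      have hjb : j ≠ b := by
        rintro rfl
        linarith
      obtain rfl | hk := eq_or_ne k b
      · simp only [Function.update_self, Function.update_of_ne hjb]
        linarith
      · simpa [hk, hjb] using hc i j hij k
  · dsimp only
    split_ifs
    · simpa using hle i b
    · exact le_rfl
  · dsimp only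
    rw [if_pos fun j _ => (hi j).trans (by linarith), Pi.single_eq_same]

/-- At equilibrium, a vendor that is optimal for a buyer type buying elsewhere prices at cost. -/
theorem IsEquilibrium.price_eq_cost [DecidableEq M] {G : PCGame N M} {x : N → M → ℝ} {q : M → ℝ}
    (h : G.IsEquilibrium x q) {i : N} {a b : M} (hab : a ≠ b) (hxa : 0 < x i a)
    (hopt : G.v i a - q a ≤ G.v i b - q b) : q b = G.c b := by
  obtain ⟨hq, hx, hc, hdev⟩ := h
  obtain rfl | hb := eq_or_ne b G.abstain
  · rw [hq.2, G.c_abstain]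
  by_contra hne
  have hd : 0 < q b - G.c b := sub_pos.2 (lt_of_le_of_ne (hq.1 b) (Ne.symm hne))
  set d := q b - G.c b with hd_def
  set S := ∑ k, x k b
  have hS : 0 ≤ S := sum_nonneg fun k _ => hx.1 k b
  have hSx : 0 < S + x i a := by linarith
  set ε := d * x i a / (2 * (S + x i a)) with hε_def
  have hε : 0 < ε := by positivity
  have hεeq : 2 * (ε * (S + x i a)) = d * x i a := by
    rw [hε_def]
    field_simp
  have hεd : ε ≤ d := by
    rw [hε_def, div_le_iff₀ (by linarith)]
    exact mul_le_mul_of_nonneg_left (by linarith) hd.le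
  obtain ⟨y, hy, hyc, hxy, hyμ⟩ :=
    exists_consistent_of_price_le hx hc b (p := q b - ε) (by linarith)
  have hle := hdev b hb (q b - ε) (by linarith) y hy hyc
  simp only [util, Function.update_self] at hle
  have hgain : S + x i a ≤ ∑ k, y k b := by
    have hyi := hyμ i fun j => (hc i a hxa j).trans hopt
    have hpair : x i a + x i b ≤ G.μ i := by
      rw [← hx.2 i, ← sum_pair (f := x i) hab]
      exact sum_le_sum_of_subset_of_nonneg (subset_univ _) fun k _ _ => hx.1 i k
    have hsub := single_le_sum (f := fun k => y k b - x k b)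
      (fun k _ => sub_nonneg.2 (hxy k)) (mem_univ i)
    rw [sum_sub_distrib] at hsub
    linarith
  have hmul := mul_le_mul_of_nonneg_left hgain (sub_nonneg.2 hεd)
  have hpos : 0 < d * x i a := mul_pos hd hxa
  have hprice : q b - ε - G.c b = d - ε := by
    rw [hd_def]
    ring
  rw [hprice] at hle
  linarith

end PCGame

/-- The cyclic successor on residues below `n` is injective. -/
theorem Fin.injective_add_one_mod {n : ℕ} (hn : 0 < n) :
    Function.Injective fun k : Fin n => (⟨(k.val + 1) % n, Nat.mod_lt _ hn⟩ : Fin n) := by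
  intro a b hab
  have hmod : a.val ≡ b.val [MOD n] := Nat.ModEq.add_right_cancel' 1 (Fin.ext_iff.1 hab)
  exact Fin.ext (hmod.eq_of_lt_of_lt a.isLt b.isLt)

/-- The cyclic successor on at least two residues has no fixed point. -/
theorem Fin.add_one_mod_ne_self {n : ℕ} (hn : 2 ≤ n) (k : Fin n) : (k.val + 1) % n ≠ k.val := by
  rcases (Nat.succ_le_of_lt k.isLt).lt_or_eq with hk | hk
  · rw [Nat.mod_eq_of_lt hk]
    omega
  · rw [show k.val + 1 = n from hk, Nat.mod_self]
    omega

/-- A real function that does not decrease along an injective self-map of a finite type is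
invariant under it. -/
theorem eq_comp_of_le_comp_of_injective {α : Type*} [Fintype α] {s : α → α}
    (hs : Function.Injective s) {f : α → ℝ} (hf : ∀ k, f k ≤ f (s k)) (k : α) : f k = f (s k) :=
  (sum_eq_sum_iff_of_le fun k _ => hf k).1
    ((Finite.injective_iff_bijective.1 hs).sum_comp f).symm k (mem_univ k)

/-- along a directed cycle of `H`, every vendor prices at cost at
equilibrium, and the labelling buyer types are indifferent between consecutive
vendors on the cycle. -/
theorem stmt8 {N M : Type} [Fintype N] [Fintype M] [DecidableEq M]
    (G : PCGame N M) (x : N → M → ℝ) (q : M → ℝ)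
    (h : G.IsEquilibrium x q)
    (ℓ : ℕ) (hℓ : 2 ≤ ℓ)
    (j : Fin ℓ → M) (hinj : Function.Injective j)
    (i : Fin ℓ → N)
    (hcyc : ∀ k : Fin ℓ, 0 < x (i k) (j k) ∧
      G.v (i k) (j k) - G.c (j k) ≤
        G.v (i k) (j ⟨(k.val + 1) % ℓ, Nat.mod_lt _ (by omega)⟩) -
          G.c (j ⟨(k.val + 1) % ℓ, Nat.mod_lt _ (by omega)⟩)) :
    ∀ k : Fin ℓ, q (j k) = G.c (j k) ∧
      G.v (i k) (j k) - q (j k) =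
        G.v (i k) (j ⟨(k.val + 1) % ℓ, Nat.mod_lt _ (by omega)⟩) -
          q (j ⟨(k.val + 1) % ℓ, Nat.mod_lt _ (by omega)⟩) := by
  set s : Fin ℓ → Fin ℓ := fun k => ⟨(k.val + 1) % ℓ, Nat.mod_lt _ (by omega)⟩
  have hs : Function.Injective s := Fin.injective_add_one_mod (by omega)
  have hcons : ∀ k, G.v (i k) (j (s k)) - q (j (s k)) ≤ G.v (i k) (j k) - q (j k) := fun k =>
    h.2.2.1 (i k) (j k) (hcyc k).1 (j (s k))
  have hcost : ∀ k, G.v (i k) (j k) - G.c (j k) ≤ G.v (i k) (j (s k)) - G.c (j (s k)) :=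
    fun k => (hcyc k).2
  have hmargin := eq_comp_of_le_comp_of_injective hs (f := fun k => q (j k) - G.c (j k))
    fun k => by linarith [hcons k, hcost k]
  have hindiff : ∀ k, G.v (i k) (j k) - q (j k) = G.v (i k) (j (s k)) - q (j (s k)) :=
    fun k => le_antisymm (by linarith [hmargin k, hcost k]) (hcons k)
  refine fun k => ⟨?_, hindiff k⟩
  have hne : j k ≠ j (s k) := fun hjk =>
    Fin.add_one_mod_ne_self hℓ k (congrArg Fin.val (hinj hjk)).symm
  linarith [hmargin k, h.price_eq_cost hne (hcyc k).1 (hindiff k).le]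
end

section
/- In every price competition game, let x be an assignment with x_{ij} ∈ {0, μ_i} for every buyer type i and vendor j that assigns each buyer type i entirely to a vendor maximizing v_{ij} − c_j over j ∈ M (so SW(x) = SW*), and let p be the price vector with p_j = c_j for every vendor j. Then x is consistent to p, s_j(x,p) ≤ ∑_{i∈N} x_{ij}(v_{ij} − c_j) for every vendor j, and the total subsidy cost ∑_{j∈M} s_j(x,p) is at most SW*. Hence the optimal assignment can always be enforced as an equilibrium using subsidies of total cost at most the optimal social welfare SW*. -/
open Finset

namespace PCGame

variable {N M : Type} [Fintype N] [Fintype M]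

theorem IsAssignment.le_μ {G : PCGame N M} {x : N → M → ℝ} (hx : G.IsAssignment x)
    (i : N) (j : M) : x i j ≤ G.μ i := by
  rw [← hx.2 i]
  exact Finset.single_le_sum (fun k _ => hx.1 i k) (Finset.mem_univ j)

theorem IsAssignment.exists_pos {G : PCGame N M} {x : N → M → ℝ} (hx : G.IsAssignment x)
    (i : N) : ∃ j, 0 < x i j := by
  by_contra! h
  have hsum : ∑ j, x i j ≤ 0 := Finset.sum_nonpos fun j _ => h j
  linarith [G.μ_pos i, hx.2 i]

/-- An assignment consistent to at-cost prices has optimal social welfare. -/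
theorem Consistent.SW_eq_SWopt {G : PCGame N M} {x : N → M → ℝ} (hx : G.IsAssignment x)
    (hc : G.Consistent x G.c) : G.SW x = G.SWopt := by
  refine Finset.sum_congr rfl fun i _ => ?_
  rw [← hx.2 i, Finset.sum_mul]
  refine Finset.sum_congr rfl fun j _ => ?_
  rcases (hx.1 i j).eq_or_lt with h | h
  · simp [← h]
  · congr 1
    exact le_antisymm (Finset.le_sup' (fun j => G.v i j - G.c j) (Finset.mem_univ j))
      (Finset.sup'_le _ _ fun j' _ => hc i j h j')

theorem Consistent.surplus_nonneg {G : PCGame N M} {x : N → M → ℝ} (hx : G.IsAssignment x)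
    (hc : G.Consistent x G.c) (i : N) (j : M) : 0 ≤ x i j * (G.v i j - G.c j) := by
  rcases (hx.1 i j).eq_or_lt with h | h
  · simp [← h]
  · have := hc i j h G.abstain
    rw [G.v_abstain, G.c_abstain, sub_zero] at this
    exact mul_nonneg h.le this

theorem util_cost (G : PCGame N M) (x : N → M → ℝ) (j : M) : G.util x G.c j = 0 := by
  simp [util]

/-- When all other vendors price at cost, the best deviation of a vendor earns at most the welfare
it generates in an integral optimal assignment. -/
theorem theta_cost_le [DecidableEq M] {G : PCGame N M} {x : N → M → ℝ} (hx : G.IsAssignment x)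
    (hx01 : ∀ i j, x i j = 0 ∨ x i j = G.μ i) (hc : G.Consistent x G.c) (j : M) :
    G.theta G.c j ≤ ∑ i, x i j * (G.v i j - G.c j) := by
  refine Real.sSup_le ?_ (Finset.sum_nonneg fun i _ => hc.surplus_nonneg hx i j)
  rintro u ⟨p', y, hp', habs, hy, hyc, rfl⟩
  rw [util, Function.update_self, Finset.mul_sum]
  refine Finset.sum_le_sum fun i _ => ?_
  rcases hp'.eq_or_lt with h | h
  · simpa [← h] using hc.surplus_nonneg hx i j
  rcases (hy.1 i j).eq_or_lt with h0 | h0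
  · simpa [← h0] using hc.surplus_nonneg hx i j
  have hj : G.abstain ≠ j := by
    rintro rfl
    rw [habs rfl, G.c_abstain] at h
    exact h.false
  have hbest : ∀ k, k ≠ j → G.v i k - G.c k ≤ G.v i j - p' := fun k hk => by
    simpa [Function.update_of_ne hk] using hyc i j h0 k
  have hxj : x i j = G.μ i := by
    obtain ⟨k, hk⟩ := hx.exists_pos i
    obtain rfl : k = j := by
      by_contra hkj
      linarith [hbest k hkj, hc i k hk j]
    exact (hx01 i k).resolve_left hk.ne'
  have hv := hbest _ hj
  rw [G.v_abstain, G.c_abstain] at hv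
  rw [hxj, mul_comm]
  exact mul_le_mul (hy.le_μ i j) (by linarith) (by linarith) (G.μ_pos i).le

end PCGame

/-- the optimal assignment together with at-cost prices can be enforced
as an equilibrium with total subsidies at most the optimal social welfare. -/
theorem stmt13 {N M : Type} [Fintype N] [Fintype M] [DecidableEq M]
    (G : PCGame N M) (x : N → M → ℝ)
    (hx : G.IsAssignment x)
    (hx01 : ∀ i j, x i j = 0 ∨ x i j = G.μ i)
    (hxopt : ∀ i j, 0 < x i j → ∀ j', G.v i j' - G.c j' ≤ G.v i j - G.c j)
    (p : M → ℝ) (hp : p = G.c) :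
    G.Consistent x p ∧ G.SW x = G.SWopt ∧
      (∀ j, G.subsidy x p j ≤ ∑ i, x i j * (G.v i j - G.c j)) ∧
      ∑ j, G.subsidy x p j ≤ G.SWopt := by
  subst hp
  have hsub : ∀ j, G.subsidy x G.c j ≤ ∑ i, x i j * (G.v i j - G.c j) := fun j => by
    rw [PCGame.subsidy, PCGame.util_cost, sub_zero]
    exact PCGame.theta_cost_le hx hx01 hxopt j
  have hSW : G.SW x = G.SWopt := PCGame.Consistent.SW_eq_SWopt hx hxopt
  refine ⟨hxopt, hSW, hsub, (Finset.sum_le_sum fun j _ => hsub j).trans_eq ?_⟩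
  rw [← hSW, PCGame.SW, Finset.sum_comm]
end
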